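/- Fix a prime p. Then δ(n, p) tends to 1 as the natural number n tends to infinity; that is, the sequence n ↦ δ(n, p) converges to 1, where δ(n, p) = 1 − (Σ_{d=1}^{n} [n choose d]_p · [d choose 1]_p · (a_{d,p} − a_{d−1,p})) / ([n choose 1]_p · (a_{n,p} − 1) · a_{n−1,p}). -/

import Mathlib

/-- `a_{m,p}`: the number of `𝔽_p`-linear subspaces of the vector space `𝔽_p^m`. -/
noncomputable def numSubspaces (p m : ℕ) : ℕ :=
  Nat.card (Submodule (ZMod p) (Fin m → ZMod p))

/-- The Gaussian (`p`-)binomial coefficient `[n choose d]_p`: the number of `d`-dimensional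
subspaces of the `𝔽_p`-vector space `𝔽_p^n`. -/
noncomputable def gaussBinom (p n d : ℕ) : ℕ :=
  Nat.card {W : Submodule (ZMod p) (Fin n → ZMod p) // Module.finrank (ZMod p) W = d}

/-- The density `δ(n, p)` of the reduced formal context of `Sat(Sub(C_p^n))`. -/
noncomputable def density (n p : ℕ) : ℝ :=
  1 - (∑ d ∈ Finset.Icc 1 n, (gaussBinom p n d : ℝ) * (gaussBinom p d 1 : ℝ) *
        ((numSubspaces p d : ℝ) - (numSubspaces p (d - 1) : ℝ))) /
      ((gaussBinom p n 1 : ℝ) * ((numSubspaces p n : ℝ) - 1) * (numSubspaces p (n - 1) : ℝ))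

/-- A `d`-dimensional subspace has at least `p ^ (d * (d - 1))` ordered bases, and is determined by
each of them. -/
theorem gaussBinom_le (p : ℕ) (hp : p.Prime) {n d : ℕ} (hd : d ≤ n) :
    gaussBinom p n d ≤ p ^ (d * (n - d + 1)) := by
  have : Fact p.Prime := ⟨hp⟩
  let f : (Σ W : {W : Submodule (ZMod p) (Fin n → ZMod p) // Module.finrank (ZMod p) W = d},
      {s : Fin d → W.1 // LinearIndependent (ZMod p) s}) → (Fin d → Fin n → ZMod p) :=
    fun x i => (x.2.1 i : Fin n → ZMod p)
  have hspan : ∀ x, Submodule.span (ZMod p) (Set.range (f x)) = x.1.1 := by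
    rintro ⟨⟨W, hW⟩, s, hs⟩
    have h : Submodule.span (ZMod p) (Set.range s) = ⊤ :=
      hs.span_eq_top_of_card_eq_finrank' (by simp [hW])
    have hr : Set.range (f ⟨⟨W, hW⟩, s, hs⟩) = W.subtype '' Set.range s := by
      rw [← Set.range_comp]; rfl
    rw [hr, Submodule.span_image, h]
    simp
  have hf : Function.Injective f := by
    rintro ⟨⟨W, hW⟩, s, hs⟩ ⟨⟨W', hW'⟩, s', hs'⟩ h
    obtain rfl : W = W' := by
      simpa only [hspan] using congrArg (fun g => Submodule.span (ZMod p) (Set.range g)) h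
    obtain rfl : s = s' := funext fun i => Subtype.ext (congrFun h i)
    rfl
  have hcard := Nat.card_le_card_of_injective f hf
  have hbases : ∀ W : {W : Submodule (ZMod p) (Fin n → ZMod p) // Module.finrank (ZMod p) W = d},
      p ^ ((d - 1) * d) ≤ Nat.card {s : Fin d → W.1 // LinearIndependent (ZMod p) s} := by
    rintro ⟨W, hW⟩
    rw [card_linearIndependent hW.ge, hW, ZMod.card, pow_mul]
    calc (p ^ (d - 1)) ^ d = ∏ _i : Fin d, p ^ (d - 1) := by simp
      _ ≤ _ := by
        refine Finset.prod_le_prod' fun i _ => ?_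
        have hi := i.2
        have h1 : p ^ (i : ℕ) ≤ p ^ (d - 1) := Nat.pow_le_pow_right hp.pos (by omega)
        have h2 : p ^ d = p ^ (d - 1) * p := by
          rw [← pow_succ, Nat.sub_add_cancel (by omega)]
        have h3 := Nat.mul_le_mul_left (p ^ (d - 1)) hp.two_le
        omega
  have hpos : 0 < p ^ ((d - 1) * d) := pow_pos hp.pos _
  refine Nat.le_of_mul_le_mul_right ?_ hpos
  calc gaussBinom p n d * p ^ ((d - 1) * d)
      ≤ ∑ W : {W : Submodule (ZMod p) (Fin n → ZMod p) // Module.finrank (ZMod p) W = d},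
          Nat.card {s : Fin d → W.1 // LinearIndependent (ZMod p) s} := by
        rw [gaussBinom, Nat.card_eq_fintype_card, ← smul_eq_mul, ← Finset.card_univ]
        exact Finset.card_nsmul_le_sum _ _ _ fun W _ => hbases W
    _ ≤ Nat.card (Fin d → Fin n → ZMod p) := by rwa [← Nat.card_sigma]
    _ = p ^ (d * (n - d + 1)) * p ^ ((d - 1) * d) := by
        rw [← pow_add]
        simp only [Nat.card_eq_fintype_card, Fintype.card_fun, ZMod.card, Fintype.card_fin,
          ← pow_mul]
        congr 1
        obtain ⟨k, rfl⟩ := Nat.exists_eq_add_of_le hd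
        rcases d with _ | d
        · simp
        · simp only [Nat.add_sub_cancel_left, Nat.add_sub_cancel]
          ring

theorem numSubspaces_le (p : ℕ) (hp : p.Prime) (d : ℕ) :
    numSubspaces p d ≤ p ^ (d + (d + 1) ^ 2 / 4) := by
  have : Fact p.Prime := ⟨hp⟩
  let f : Submodule (ZMod p) (Fin d → ZMod p) → Σ k : Fin (d + 1),
      {W : Submodule (ZMod p) (Fin d → ZMod p) // Module.finrank (ZMod p) W = k} := fun W =>
    ⟨⟨Module.finrank (ZMod p) W, Nat.lt_succ_of_le (by simpa using Submodule.finrank_le W)⟩,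
      W, rfl⟩
  have hf : Function.Injective f := fun W W' h => congrArg (fun x => x.2.1) h
  calc numSubspaces p d ≤ ∑ k : Fin (d + 1), gaussBinom p d k := by
        simpa only [Nat.card_sigma, gaussBinom, numSubspaces] using
          Nat.card_le_card_of_injective f hf
    _ ≤ ∑ _k : Fin (d + 1), p ^ ((d + 1) ^ 2 / 4) := by
        refine Finset.sum_le_sum fun k _ => (gaussBinom_le p hp (Nat.le_of_lt_succ k.2)).trans ?_
        refine Nat.pow_le_pow_right hp.pos ((Nat.le_div_iff_mul_le (by norm_num)).2 ?_)
        zify [Nat.le_of_lt_succ k.2]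
        nlinarith [sq_nonneg (2 * (k : ℤ) - (d + 1))]
    _ ≤ p ^ (d + (d + 1) ^ 2 / 4) := by
        rw [Finset.sum_const, Finset.card_univ, Fintype.card_fin, smul_eq_mul, pow_add]
        exact Nat.mul_le_mul_right _ (Nat.lt_pow_self hp.one_lt)

/-- The graphs of the linear maps `𝔽_p^k → 𝔽_p^m` are distinct subspaces of `𝔽_p^(k + m)`. -/
theorem pow_le_numSubspaces (p : ℕ) (hp : p.Prime) (k m : ℕ) :
    p ^ (k * m) ≤ numSubspaces p (k + m) := by
  have : Fact p.Prime := ⟨hp⟩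
  let e : ((Fin k → ZMod p) × (Fin m → ZMod p)) ≃ₗ[ZMod p] (Fin (k + m) → ZMod p) :=
    LinearEquiv.ofFinrankEq _ _ (by simp)
  let f : ((Fin k → ZMod p) →ₗ[ZMod p] (Fin m → ZMod p)) →
      Submodule (ZMod p) (Fin (k + m) → ZMod p) := fun g => g.graph.map e.toLinearMap
  have hf : Function.Injective f := by
    intro g g' h
    have hg : g.graph = g'.graph := Submodule.map_injective_of_injective e.injective h
    refine LinearMap.ext fun x => ?_
    have hx : (x, g x) ∈ g.graph := by simp
    rw [hg, LinearMap.mem_graph_iff] at hx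
    exact hx
  calc p ^ (k * m) = Nat.card ((Fin k → ZMod p) →ₗ[ZMod p] (Fin m → ZMod p)) := by
        rw [Module.natCard_eq_pow_finrank (K := ZMod p), Module.finrank_linearMap]
        simp
    _ ≤ _ := Nat.card_le_card_of_injective f hf

theorem gaussBinom_one_pos (p : ℕ) (hp : p.Prime) {n : ℕ} (hn : 0 < n) :
    0 < gaussBinom p n 1 := by
  have : Fact p.Prime := ⟨hp⟩
  have : Nonempty (Fin n) := ⟨⟨0, hn⟩⟩
  obtain ⟨v, hv⟩ := exists_ne (0 : Fin n → ZMod p)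
  have : Nonempty {W : Submodule (ZMod p) (Fin n → ZMod p) // Module.finrank (ZMod p) W = 1} :=
    ⟨⟨Submodule.span (ZMod p) {v}, finrank_span_singleton hv⟩⟩
  exact Nat.card_pos

theorem numerator_exponent_le {n d : ℕ} (hn : 40 ≤ n) (hd : d ≤ n) :
    d * (n - d + 1) + d + (d + (d + 1) ^ 2 / 4) + 2 * n + 1 ≤
      n / 2 * (n - n / 2) + (n - 1) / 2 * (n - 1 - (n - 1) / 2) := by
  obtain ⟨k, rfl⟩ := Nat.exists_eq_add_of_le hd
  have h1 : (d + 1) ^ 2 / 4 * 4 ≤ (d + 1) ^ 2 := Nat.div_mul_le_self _ _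
  have key : ∀ m : ℕ, m ^ 2 ≤ 4 * (m / 2 * (m - m / 2)) + 1 := by
    intro m
    obtain ⟨t, rfl | rfl⟩ := m.even_or_odd'
    · rw [show 2 * t / 2 = t by omega, show 2 * t - t = t by omega]; nlinarith
    · rw [show (2 * t + 1) / 2 = t by omega, show 2 * t + 1 - t = t + 1 by omega]; nlinarith
  have h2 := key (d + k)
  have h3 := key (d + k - 1)
  rw [Nat.add_sub_cancel_left]
  generalize (d + 1) ^ 2 / 4 = x at *
  generalize (d + k) / 2 * (d + k - (d + k) / 2) = y at *
  generalize (d + k - 1) / 2 * (d + k - 1 - (d + k - 1) / 2) = z at *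
  obtain ⟨j, hj⟩ : ∃ j, d + k = j + 1 := ⟨d + k - 1, by omega⟩
  rw [hj, Nat.add_sub_cancel] at h3
  zify at *
  rw [show (j : ℤ) = d + k - 1 by linarith] at h3
  nlinarith [sq_nonneg ((d : ℤ) - 2 * k - 7), sq_nonneg ((d : ℤ) + k - 40)]

/-- For fixed prime `p`, the sequence `n ↦ δ(n, p)` converges to `1`. -/
theorem density_tendsto_one_in_n (p : ℕ) (hp : p.Prime) :
    Filter.Tendsto (fun n : ℕ => density n p) Filter.atTop (nhds 1) := by
  have hp2 : (2 : ℝ) ≤ p := mod_cast hp.two_le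
  have hp1 : (1 : ℝ) ≤ p := by linarith
  have hp0 : (0 : ℝ) < p := by linarith
  suffices h : ∀ᶠ n : ℕ in Filter.atTop, |1 - density n p| ≤ (1 / (p : ℝ)) ^ n by
    have hlim : Filter.Tendsto (fun n : ℕ => (1 / (p : ℝ)) ^ n) Filter.atTop (nhds 0) :=
      tendsto_pow_atTop_nhds_zero_of_lt_one (by positivity)
        ((div_lt_one hp0).2 (by linarith))
    have hsub : Filter.Tendsto (fun n : ℕ => 1 - density n p) Filter.atTop (nhds 0) :=
      squeeze_zero_norm' h hlim
    simpa using hsub.const_sub 1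
  filter_upwards [Filter.eventually_ge_atTop 40] with n hn
  set D := n / 2 * (n - n / 2) with hD
  set D' := (n - 1) / 2 * (n - 1 - (n - 1) / 2)
  have hterm : ∀ d ∈ Finset.Icc 1 n, |(gaussBinom p n d : ℝ) * (gaussBinom p d 1 : ℝ) *
      ((numSubspaces p d : ℝ) - (numSubspaces p (d - 1) : ℝ))| * (p : ℝ) ^ (2 * n + 1) ≤
        (p : ℝ) ^ (D + D') := by
    intro d hd
    obtain ⟨hd1, hdn⟩ := Finset.mem_Icc.1 hd
    have h1 : (gaussBinom p n d : ℝ) ≤ (p : ℝ) ^ (d * (n - d + 1)) :=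
      mod_cast gaussBinom_le p hp hdn
    have h2 : (gaussBinom p d 1 : ℝ) ≤ (p : ℝ) ^ d := by
      have := gaussBinom_le p hp hd1
      rw [one_mul, Nat.sub_add_cancel hd1] at this
      exact_mod_cast this
    have h3 : (numSubspaces p d : ℝ) ≤ (p : ℝ) ^ (d + (d + 1) ^ 2 / 4) :=
      mod_cast numSubspaces_le p hp d
    have h4 : (numSubspaces p (d - 1) : ℝ) ≤ (p : ℝ) ^ (d + (d + 1) ^ 2 / 4) := by
      have h : d - 1 + (d - 1 + 1) ^ 2 / 4 ≤ d + (d + 1) ^ 2 / 4 := by gcongr <;> omega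
      exact_mod_cast (numSubspaces_le p hp (d - 1)).trans (Nat.pow_le_pow_right hp.pos h)
    have h5 : |(numSubspaces p d : ℝ) - (numSubspaces p (d - 1) : ℝ)| ≤
        (p : ℝ) ^ (d + (d + 1) ^ 2 / 4) :=
      abs_sub_le_of_nonneg_of_le (by positivity) h3 (by positivity) h4
    rw [abs_mul, abs_of_nonneg (a := (gaussBinom p n d : ℝ) * _) (by positivity)]
    calc _ ≤ (p : ℝ) ^ (d * (n - d + 1)) * (p : ℝ) ^ d * (p : ℝ) ^ (d + (d + 1) ^ 2 / 4) *
          (p : ℝ) ^ (2 * n + 1) := by gcongr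
      _ ≤ (p : ℝ) ^ (D + D') := by
        simp only [← pow_add]
        exact pow_le_pow_right₀ hp1 (numerator_exponent_le hn hdn)
  have hnum : |∑ d ∈ Finset.Icc 1 n, (gaussBinom p n d : ℝ) * (gaussBinom p d 1 : ℝ) *
      ((numSubspaces p d : ℝ) - (numSubspaces p (d - 1) : ℝ))| * (p : ℝ) ^ (n + 1) ≤
        (p : ℝ) ^ (D + D') := by
    have hpn : (n : ℝ) ≤ (p : ℝ) ^ n := mod_cast (Nat.lt_pow_self hp.one_lt).le
    have hpow : (0 : ℝ) < (p : ℝ) ^ n := by positivity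
    refine le_of_mul_le_mul_right ?_ hpow
    calc _ ≤ (∑ d ∈ Finset.Icc 1 n, |(gaussBinom p n d : ℝ) * (gaussBinom p d 1 : ℝ) *
            ((numSubspaces p d : ℝ) - (numSubspaces p (d - 1) : ℝ))|) *
              (p : ℝ) ^ (n + 1) * (p : ℝ) ^ n := by
          gcongr
          exact Finset.abs_sum_le_sum_abs _ _
      _ = ∑ d ∈ Finset.Icc 1 n, |(gaussBinom p n d : ℝ) * (gaussBinom p d 1 : ℝ) *
            ((numSubspaces p d : ℝ) - (numSubspaces p (d - 1) : ℝ))| * (p : ℝ) ^ (2 * n + 1) := by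
          rw [mul_assoc, ← pow_add, Finset.sum_mul]
          congr! 3
          ring
      _ ≤ n * (p : ℝ) ^ (D + D') := by
          simpa using Finset.sum_le_sum hterm
      _ ≤ (p : ℝ) ^ (D + D') * (p : ℝ) ^ n := by
          rw [mul_comm]; gcongr
  have hg : (1 : ℝ) ≤ gaussBinom p n 1 := mod_cast gaussBinom_one_pos p hp (by omega)
  have ha : (p : ℝ) ^ D ≤ numSubspaces p n := by
    have := pow_le_numSubspaces p hp (n / 2) (n - n / 2)
    rw [Nat.add_sub_cancel' (Nat.div_le_self _ _)] at this
    exact_mod_cast this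
  have ha' : (p : ℝ) ^ D' ≤ numSubspaces p (n - 1) := by
    have := pow_le_numSubspaces p hp ((n - 1) / 2) (n - 1 - (n - 1) / 2)
    rw [Nat.add_sub_cancel' (Nat.div_le_self _ _)] at this
    exact_mod_cast this
  have hD1 : D ≠ 0 := by
    rw [hD]; exact Nat.mul_ne_zero (by omega) (by omega)
  have hpD : (p : ℝ) ≤ (p : ℝ) ^ D := le_self_pow₀ hp1 hD1
  have hden : (p : ℝ) ^ (D + D') ≤ p * ((gaussBinom p n 1 : ℝ) * ((numSubspaces p n : ℝ) - 1) *
      (numSubspaces p (n - 1) : ℝ)) := by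
    have h1 : (p : ℝ) ^ D ≤ p * ((numSubspaces p n : ℝ) - 1) := by nlinarith
    have h2 : (0 : ℝ) ≤ (numSubspaces p n : ℝ) - 1 := by linarith
    calc (p : ℝ) ^ (D + D') = 1 * (p : ℝ) ^ D * (p : ℝ) ^ D' := by rw [pow_add, one_mul]
      _ ≤ (gaussBinom p n 1 : ℝ) * (p * ((numSubspaces p n : ℝ) - 1)) *
          (numSubspaces p (n - 1) : ℝ) := by gcongr
      _ = _ := by ring
  have hpos : 0 < (gaussBinom p n 1 : ℝ) * ((numSubspaces p n : ℝ) - 1) *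
      (numSubspaces p (n - 1) : ℝ) :=
    pos_of_mul_pos_right (lt_of_lt_of_le (by positivity) hden) hp0.le
  rw [density, sub_sub_cancel, abs_div, abs_of_pos hpos, div_le_iff₀ hpos, one_div, inv_pow,
    inv_mul_eq_div, le_div_iff₀ (by positivity)]
  refine le_of_mul_le_mul_right ?_ hp0
  rw [mul_assoc, ← pow_succ, mul_comm _ (p : ℝ)]
  exact hnum.trans hden
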